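/- A pseudo-Boolean function f : B^n → ℝ (with n ≥ 2) is locally monotone (i.e., 2-locally monotone) if and only if every binary section g of f satisfies a_1(a_1 + a_12) ≥ 0 and a_2(a_2 + a_12) ≥ 0, where a_1 = g(1,0) − g(0,0), a_2 = g(0,1) − g(0,0) and a_12 = g(1,1) − g(1,0) − g(0,1) + g(0,0) are the coefficients of the multilinear representation g(x_1,x_2) = a_0 + a_1 x_1 + a_2 x_2 + a_12 x_1 x_2. -/

import Mathlib

open Finset

/-- Discrete partial derivative: `Δ_k f (x) = f(x_k^1) - f(x_k^0)`. -/
def pderiv {ι : Type*} [DecidableEq ι] (f : (ι → Bool) → ℝ) (k : ι) (x : ι → Bool) : ℝ :=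
  f (Function.update x k true) - f (Function.update x k false)

/-- Meet derivative: `∧_k f (x) = f(x_k^0) ⊓ f(x_k^1)`. -/
def meetD {ι : Type*} [DecidableEq ι] (f : (ι → Bool) → ℝ) (k : ι) (x : ι → Bool) : ℝ :=
  min (f (Function.update x k false)) (f (Function.update x k true))

/-- Join derivative: `∨_k f (x) = f(x_k^0) ⊔ f(x_k^1)`. -/
def joinD {ι : Type*} [DecidableEq ι] (f : (ι → Bool) → ℝ) (k : ι) (x : ι → Bool) : ℝ :=
  max (f (Function.update x k false)) (f (Function.update x k true))

/-- `f` is `p`-locally monotone: no partial derivative changes sign on tuples differing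
in fewer than `p` positions (other than the `k`-th one). -/
def LocallyMonotone {n : ℕ} (p : ℕ) (f : (Fin n → Bool) → ℝ) : Prop :=
  ∀ k : Fin n, ∀ x y : Fin n → Bool,
    (Finset.univ.filter (fun i => i ≠ k ∧ x i ≠ y i)).card < p →
    0 ≤ pderiv f k x * pderiv f k y

/-- A lattice-derivative operator: `(true, k)` is `∨_k`, `(false, k)` is `∧_k`. -/
def latD {ι : Type*} [DecidableEq ι] (ok : Bool × ι) (f : (ι → Bool) → ℝ) : (ι → Bool) → ℝ :=
  if ok.1 then joinD f ok.2 else meetD f ok.2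

/-- Composition `O_{k_1} ⋯ O_{k_p} f` of the operators listed in `l`. -/
def applyOps {ι : Type*} [DecidableEq ι] (l : List (Bool × ι)) (f : (ι → Bool) → ℝ) :
    (ι → Bool) → ℝ := l.foldr latD f

/-- `f` has `p`-permutable lattice derivatives. -/
def Permutable {ι : Type*} [DecidableEq ι] (p : ℕ) (f : (ι → Bool) → ℝ) : Prop :=
  ∀ l l' : List (Bool × ι), l.length = p → (l.map Prod.snd).Nodup → l.Perm l' →
    applyOps l f = applyOps l' f

/-- `f` is monotone: each partial derivative is everywhere nonnegative or everywhere
nonpositive. -/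
def IsMonotoneFn {ι : Type*} [DecidableEq ι] (f : (ι → Bool) → ℝ) : Prop :=
  ∀ k : ι, (∀ x, 0 ≤ pderiv f k x) ∨ (∀ x, pderiv f k x ≤ 0)

/-- The tuple `a_S^x`: `i`-th component `x i` if `i ∈ S`, and `a i` otherwise. -/
def restrictTo {n : ℕ} (S : Finset (Fin n)) (a : Fin n → Bool) (x : {i // i ∈ S} → Bool) :
    Fin n → Bool := fun i => if h : i ∈ S then x ⟨i, h⟩ else a i

/-- `g` is an `S`-section of `f`. -/
def IsSection {n : ℕ} (S : Finset (Fin n)) (f : (Fin n → Bool) → ℝ)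
    (g : ({i // i ∈ S} → Bool) → ℝ) : Prop :=
  ∃ a : Fin n → Bool, ∀ x, g x = f (restrictTo S a x)

/-- A Boolean function viewed as real-valued. -/
def toReal {n : ℕ} (f : (Fin n → Bool) → Bool) : (Fin n → Bool) → ℝ :=
  fun x => if f x then 1 else 0

/-- `g` is a binary section of `f` (variables `j ≠ k`, other variables fixed to `a`). -/
def IsBinSection {n : ℕ} (f : (Fin n → Bool) → ℝ) (g : Bool → Bool → ℝ) : Prop :=
  ∃ j k : Fin n, j ≠ k ∧ ∃ a : Fin n → Bool,
    ∀ u v : Bool, g u v = f (Function.update (Function.update a j u) k v)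

theorem pderiv_congr {ι : Type*} [DecidableEq ι] (f : (ι → Bool) → ℝ) {k : ι} {x y : ι → Bool}
    (h : ∀ i, i ≠ k → x i = y i) : pderiv f k x = pderiv f k y := by
  have key (b : Bool) : Function.update x k b = Function.update y k b := by
    ext i
    by_cases hi : i = k
    · subst hi; simp
    · simp [hi, h i hi]
  simp only [pderiv, key]

/-- Local monotonicity only needs to be tested across a single flipped coordinate. -/
theorem locallyMonotone_two_iff {n : ℕ} (hn : 2 ≤ n) (f : (Fin n → Bool) → ℝ) :
    LocallyMonotone 2 f ↔ ∀ j k : Fin n, j ≠ k → ∀ a : Fin n → Bool,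
      0 ≤ pderiv f k (Function.update a j false) * pderiv f k (Function.update a j true) := by
  constructor
  · intro h j k _ a
    refine h k _ _ (lt_of_le_of_lt (Finset.card_le_card (t := {j}) fun i hi => ?_) (by simp))
    by_contra hij
    simp_all
  · intro h k x y hxy
    have : Nontrivial (Fin n) := Fin.nontrivial_iff_two_le.mpr hn
    obtain ⟨j, hjk, hj⟩ : ∃ j, j ≠ k ∧ ∀ i, i ≠ k → i ≠ j → x i = y i := by
      rcases Finset.eq_empty_or_nonempty (univ.filter fun i => i ≠ k ∧ x i ≠ y i) with he | ⟨j, hj⟩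
      · obtain ⟨j, hj⟩ := exists_ne k
        refine ⟨j, hj, fun i hi _ => by_contra fun hne => ?_⟩
        exact Finset.notMem_empty i (he ▸ by simp [hi, hne])
      · refine ⟨j, (Finset.mem_filter.mp hj).2.1, fun i hi hij => by_contra fun hne => hij ?_⟩
        exact Finset.card_le_one.mp (Nat.lt_succ_iff.mp hxy) i (by simp [hi, hne]) j hj
    have hx : pderiv f k x = pderiv f k (Function.update x j (x j)) := by simp
    have hy : pderiv f k y = pderiv f k (Function.update x j (y j)) := by
      refine pderiv_congr f fun i hi => ?_
      by_cases hij : i = j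
      · subst hij; simp
      · simp [hij, hj i hi hij]
    rw [hx, hy]
    cases x j <;> cases y j
    · exact mul_self_nonneg _
    · exact h j k hjk x
    · rw [mul_comm]; exact h j k hjk x
    · exact mul_self_nonneg _

theorem stmt5 {n : ℕ} (hn : 2 ≤ n) (f : (Fin n → Bool) → ℝ) :
    LocallyMonotone 2 f ↔
      ∀ g : Bool → Bool → ℝ, IsBinSection f g →
        (g true false - g false false) *
            ((g true false - g false false) +
              (g true true - g true false - g false true + g false false)) ≥ 0 ∧
        (g false true - g false false) *
            ((g false true - g false false) +
              (g true true - g true false - g false true + g false false)) ≥ 0 := by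
  rw [locallyMonotone_two_iff hn]
  constructor
  · rintro h g ⟨j, k, hjk, a, hg⟩
    have hk := h j k hjk a
    have hj := h k j hjk.symm a
    simp only [pderiv, Function.update_comm hjk.symm, ← hg] at hk hj
    constructor <;> linarith
  · intro h j k hjk a
    have := (h _ ⟨j, k, hjk, a, fun _ _ => rfl⟩).2
    simp only [pderiv]
    linarith
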